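/- Let ε ≥ 0 and m, r ∈ ℕ with r ≤ m. Let M be a mechanism assigning to each membership vector s ∈ {−1,+1}^m a probability measure M(s) on an output space Ω, and suppose M satisfies (ε,0)-DP: for all s, s′ differing in exactly one coordinate and every measurable A ⊆ Ω, M(s)(A) ≤ e^ε·M(s′)(A). Let S be uniform on {−1,+1}^m (coordinates i.i.d. fair signs), let ω ~ M(S), and let Ŝ : Ω → {−1,0,+1}^m be a measurable guessing rule that almost surely makes exactly r nonzero guesses. Define the number of correct guesses W = Σ_{i=1}^m max{0, Ŝ(ω)_i · S_i}. Then for every v ∈ ℝ, Pr[W ≥ v] ≤ Pr[B ≥ v], where B ~ Binomial(r, e^ε/(e^ε+1)). -/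

import Mathlib

open MeasureTheory Real
open scoped ENNReal

/-- Upper tail Pr[Binomial(r,p) ≥ v] of the binomial distribution with r trials and
success probability p. -/
noncomputable def binomialTail (r : ℕ) (p : ℝ) (v : ℝ) : ℝ :=
  ∑ k ∈ Finset.range (r + 1),
    if v ≤ (k : ℝ) then (r.choose k : ℝ) * p ^ k * (1 - p) ^ (r - k) else 0

/-- The ±1 sign encoded by a Boolean membership bit (true = +1, false = −1). -/
def signOf (b : Bool) : ℤ := if b then 1 else -1

theorem binomialTail_zero (p v : ℝ) : binomialTail 0 p v = if v ≤ 0 then 1 else 0 := by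
  simp [binomialTail]

theorem binomialTail_nonneg (r : ℕ) {p : ℝ} (hp0 : 0 ≤ p) (hp1 : p ≤ 1) (v : ℝ) :
    0 ≤ binomialTail r p v := by
  have hq : 0 ≤ 1 - p := sub_nonneg.2 hp1
  refine Finset.sum_nonneg fun k _ => ?_
  split_ifs <;> positivity

theorem binomialTail_antitone (r : ℕ) {p : ℝ} (hp0 : 0 ≤ p) (hp1 : p ≤ 1) :
    Antitone (binomialTail r p) := by
  intro v w hvw
  have hq : 0 ≤ 1 - p := sub_nonneg.2 hp1
  refine Finset.sum_le_sum fun k _ => ?_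
  by_cases hw : w ≤ k
  · simp [hw, hvw.trans hw]
  · rw [if_neg hw]
    split_ifs <;> positivity

/-- Conditioning on one trial of the binomial distribution. -/
theorem binomialTail_succ (r : ℕ) (p v : ℝ) :
    binomialTail (r + 1) p v =
      p * binomialTail r p (v - 1) + (1 - p) * binomialTail r p v := by
  have h := Finset.sum_choose_succ_mul
    (fun i j => if v ≤ (i : ℝ) then p ^ i * (1 - p) ^ j else 0) r
  simp only [binomialTail, Finset.mul_sum]
  rw [add_comm (Finset.sum _ _)]
  calc _ = _ := by
        refine Eq.trans (Finset.sum_congr rfl fun k _ => ?_) h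
        split_ifs <;> ring
    _ = _ := by
        congr 1 <;> refine Finset.sum_congr rfl fun k hk => ?_
        · have hk' : k ≤ r := Nat.lt_succ_iff.1 (Finset.mem_range.1 hk)
          rw [Nat.sub_add_comm hk']
          split_ifs <;> ring
        · simp only [Nat.cast_add, Nat.cast_one, sub_le_iff_le_add]
          split_ifs <;> ring

/-- The number of correct guesses made by `g` on the membership vector `s`. -/
def correctGuesses {m : ℕ} (g : Fin m → ℤ) (s : Fin m → Bool) : ℤ :=
  ∑ i, max 0 (g i * signOf (s i))

theorem correctGuesses_cons {m : ℕ} (g : Fin (m + 1) → ℤ) (b : Bool) (s : Fin m → Bool) :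
    correctGuesses g (Fin.cons b s) =
      max 0 (g 0 * signOf b) + correctGuesses (fun i => g i.succ) s := by
  simp [correctGuesses, Fin.sum_univ_succ]

theorem sum_bool_vec_succ {m : ℕ} (f : (Fin (m + 1) → Bool) → ℝ) :
    ∑ s, f s = ∑ s : Fin m → Bool, f (Fin.cons true s) +
      ∑ s : Fin m → Bool, f (Fin.cons false s) := by
  rw [← (Fin.consEquiv fun _ : Fin (m + 1) => Bool).sum_comp, Fintype.sum_prod_type,
    Fintype.sum_bool]
  rfl

theorem sum_weight_correctGuesses_le {c : ℝ} (hc : 1 ≤ c) {m : ℕ} :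
    ∀ (r : ℕ) (g : Fin m → ℤ) (a : (Fin m → Bool) → ℝ) (v : ℝ),
      (∀ i, g i = -1 ∨ g i = 0 ∨ g i = 1) →
      (Finset.univ.filter fun i => g i ≠ 0).card = r →
      (∀ s i, a (Function.update s i (!s i)) ≤ c * a s) →
      ∑ s, (if v ≤ (correctGuesses g s : ℝ) then a s else 0) ≤
        binomialTail r (c / (c + 1)) v * ∑ s, a s := by
  have hc1 : 0 < c + 1 := by linarith
  have hp0 : 0 ≤ c / (c + 1) := by positivity
  have hp1 : c / (c + 1) ≤ 1 := (div_le_one hc1).2 (by linarith)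
  -- The weights of the two halves of the cube compare as the two outcomes of one biased trial.
  have mix : ∀ (r : ℕ) (v A B : ℝ), A ≤ c * B →
      binomialTail r (c / (c + 1)) (v - 1) * A + binomialTail r (c / (c + 1)) v * B ≤
        binomialTail (r + 1) (c / (c + 1)) v * (A + B) := by
    intro r v A B hAB
    have hmono := binomialTail_antitone r hp0 hp1 (sub_le_self v zero_le_one)
    have hA : A ≤ c / (c + 1) * (A + B) := by
      rw [div_mul_eq_mul_div, le_div_iff₀ hc1]
      linarith
    rw [binomialTail_succ]
    nlinarith [mul_nonneg (sub_nonneg.2 hmono) (sub_nonneg.2 hA)]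
  induction m with
  | zero =>
    intro r g a v _ hr _
    obtain rfl : r = 0 := by simpa using hr.symm
    simp [binomialTail_zero, correctGuesses]
  | succ m ih =>
    intro r g a v hg hr ha
    have htail : ∀ (b : Bool) (s : Fin m → Bool) (i : Fin m),
        a (Fin.cons b (Function.update s i (!s i))) ≤ c * a (Fin.cons b s) := by
      intro b s i
      simpa [Fin.cons_update] using ha (Fin.cons b s) i.succ
    have hhead : ∀ b : Bool, ∑ s : Fin m → Bool, a (Fin.cons (!b) s) ≤
        c * ∑ s : Fin m → Bool, a (Fin.cons b s) := by
      intro b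
      rw [Finset.mul_sum]
      refine Finset.sum_le_sum fun s _ => ?_
      simpa [Fin.update_cons_zero] using ha (Fin.cons b s) 0
    have key := fun (r' : ℕ) (b : Bool) (w : ℝ) hr' =>
      ih r' (fun i => g i.succ) (fun s => a (Fin.cons b s)) w (fun i => hg i.succ) hr' (htail b)
    rw [Fin.card_filter_univ_succ] at hr
    rw [sum_bool_vec_succ, sum_bool_vec_succ]
    simp only [correctGuesses_cons, Int.cast_add]
    rcases hg 0 with h0 | h0 | h0
    · simp only [h0, ne_eq] at hr
      norm_num at hr
      obtain ⟨r, rfl⟩ : ∃ r', r = r' + 1 := ⟨_, hr.symm⟩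
      have ht := key r true v (by simpa using hr)
      have hf := key r false (v - 1) (by simpa using hr)
      have hm := mix r v _ _ (hhead true)
      simp only [h0, signOf, sub_le_iff_le_add'] at ht hf hm ⊢
      norm_num at ht hf hm ⊢
      linarith
    · simp only [h0, ne_eq, not_true_eq_false, if_false] at hr
      have ht := key r true v hr
      have hf := key r false v hr
      simp only [h0, zero_mul, max_self, Int.cast_zero, zero_add]
      linarith
    · simp only [h0, ne_eq] at hr
      norm_num at hr
      obtain ⟨r, rfl⟩ : ∃ r', r = r' + 1 := ⟨_, hr.symm⟩
      have ht := key r true (v - 1) (by simpa using hr)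
      have hf := key r false v (by simpa using hr)
      have hm := mix r v _ _ (hhead false)
      simp only [h0, signOf, sub_le_iff_le_add'] at ht hf hm ⊢
      norm_num at ht hf hm ⊢
      linarith

/-- δ = 0 case of the O(1) auditing theorem of Steinke et al.:
for an (ε,0)-DP mechanism M on membership vectors S ∈ {−1,+1}^m (coordinates i.i.d. fair
signs), and any measurable guessing rule Sg with values in {−1,0,+1}^m making exactly r
nonzero guesses a.s., the number of correct guesses W = Σᵢ max{0, Sgᵢ·Sᵢ} satisfies
Pr[W ≥ v] ≤ Pr[Binomial(r, e^ε/(e^ε+1)) ≥ v]. -/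
theorem o1_audit_pure_dp
    {Ω : Type*} [MeasurableSpace Ω]
    (ε : ℝ) (hε : 0 ≤ ε) (m r : ℕ) (hrm : r ≤ m)
    (M : (Fin m → Bool) → Measure Ω)
    (hMprob : ∀ s, IsProbabilityMeasure (M s))
    (hDP : ∀ s s' : Fin m → Bool,
      (Finset.univ.filter (fun i => s i ≠ s' i)).card = 1 →
      ∀ A : Set Ω, MeasurableSet A →
        M s A ≤ ENNReal.ofReal (Real.exp ε) * M s' A)
    (P : Measure ((Fin m → Bool) × Ω))
    (hP : P = ∑ s : Fin m → Bool,
      ((2 : ℝ≥0∞) ^ m)⁻¹ • (M s).map (fun ω => (s, ω)))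
    (Sg : Ω → Fin m → ℤ) (hSg : Measurable Sg)
    (hvals : ∀ ω i, Sg ω i = -1 ∨ Sg ω i = 0 ∨ Sg ω i = 1)
    (hguesses : ∀ᵐ q ∂P, (Finset.univ.filter (fun i => Sg q.2 i ≠ 0)).card = r)
    (v : ℝ) :
    P {q : (Fin m → Bool) × Ω |
        v ≤ ((∑ i, max 0 (Sg q.2 i * signOf (q.1 i)) : ℤ) : ℝ)} ≤
      ENNReal.ofReal (binomialTail r (Real.exp ε / (Real.exp ε + 1)) v) := by
  have hPE : ∀ E : Set ((Fin m → Bool) × Ω), MeasurableSet E →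
      P E = ∑ s, ((2 : ℝ≥0∞) ^ m)⁻¹ * M s {ω | (s, ω) ∈ E} := by
    intro E hE
    simp only [hP, Measure.finsetSum_apply, Measure.smul_apply, smul_eq_mul]
    refine Finset.sum_congr rfl fun s _ => ?_
    rw [Measure.map_apply measurable_prodMk_left hE]
    rfl
  have hfib : ∀ g, MeasurableSet (Sg ⁻¹' {g}) := fun g => hSg (measurableSet_singleton g)
  have hnull : ∀ g : Fin m → ℤ, (Finset.univ.filter fun i => g i ≠ 0).card ≠ r →
      ∀ s, M s (Sg ⁻¹' {g}) = 0 := by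
    intro g hg s
    have h0 : P {q | Sg q.2 = g} = 0 := by
      refine measure_mono_null ?_ (ae_iff.1 hguesses)
      rintro q rfl
      exact hg
    rw [hPE {q | Sg q.2 = g} (measurable_snd (hfib g)), Finset.sum_eq_zero_iff] at h0
    exact (mul_eq_zero.1 (h0 s (Finset.mem_univ s))).resolve_left (by simp)
  set T := binomialTail r (Real.exp ε / (Real.exp ε + 1)) v
  have hT : 0 ≤ T := binomialTail_nonneg r (by positivity)
    ((div_le_one (by positivity)).2 (by linarith)) v
  let G : Finset (Fin m → ℤ) := Fintype.piFinset fun _ => {-1, 0, 1}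
  have hG : ∀ ω, Sg ω ∈ G := fun ω => by simpa [G] using hvals ω
  let a : (Fin m → ℤ) → (Fin m → Bool) → ℝ := fun g s => (M s).real (Sg ⁻¹' {g})
  have ha_sum : ∀ s, ∀ p : (Fin m → ℤ) → Prop, ∀ _ : DecidablePred p,
      ∑ g ∈ G, (if p g then a g s else 0) = (M s).real {ω | p (Sg ω)} := by
    intro s p _
    rw [← Finset.sum_filter, sum_measureReal_preimage_singleton _ fun g _ => hfib g]
    congr 1
    ext ω
    simp [hG]
  have ha_le : ∀ g ∈ G,
      ∑ s, (if v ≤ (correctGuesses g s : ℝ) then a g s else 0) ≤ T * ∑ s, a g s := by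
    intro g hg
    by_cases hr : (Finset.univ.filter fun i => g i ≠ 0).card = r
    · refine sum_weight_correctGuesses_le (Real.one_le_exp hε) r g (a g) v
        (by simpa [G] using hg) hr fun s i => ?_
      have hflip : (Finset.univ.filter
          fun j => Function.update s i (!s i) j ≠ s j).card = 1 := by
        rw [Finset.card_eq_one]
        refine ⟨i, ?_⟩
        ext j
        by_cases hj : j = i
        · subst hj
          simp
        · simp [hj]
      have h := ENNReal.toReal_mono (by finiteness) (hDP _ _ hflip _ (hfib g))
      rwa [ENNReal.toReal_mul, ENNReal.toReal_ofReal (Real.exp_nonneg ε)] at h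
    · have h0 : ∀ s, a g s = 0 := fun s => by simp [a, Measure.real, hnull g hr s]
      simp [h0]
  have hE : MeasurableSet {q : (Fin m → Bool) × Ω | v ≤ (correctGuesses (Sg q.2) q.1 : ℝ)} := by
    have hmeas : Measurable fun q : (Fin m → Bool) × Ω => (q.1, Sg q.2) :=
      measurable_fst.prodMk (hSg.comp measurable_snd)
    exact hmeas (MeasurableSet.of_discrete
      (s := {x : (Fin m → Bool) × (Fin m → ℤ) | v ≤ (correctGuesses x.2 x.1 : ℝ)}))
  change P {q : (Fin m → Bool) × Ω | v ≤ (correctGuesses (Sg q.2) q.1 : ℝ)} ≤ _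
  rw [hPE _ hE, ENNReal.le_ofReal_iff_toReal_le
    (ENNReal.sum_ne_top.2 fun s _ => ENNReal.mul_ne_top (by simp) (by finiteness)) hT,
    ENNReal.toReal_sum fun s _ => ENNReal.mul_ne_top (by simp) (by finiteness)]
  simp only [ENNReal.toReal_mul, ← Finset.mul_sum]
  calc _ = ((2 : ℝ≥0∞) ^ m)⁻¹.toReal *
        ∑ s, ∑ g ∈ G, (if v ≤ (correctGuesses g s : ℝ) then a g s else 0) := by
        congr 1
        exact Finset.sum_congr rfl fun s _ => (ha_sum s (fun g => v ≤ (correctGuesses g s : ℝ)) _).symm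
    _ = ((2 : ℝ≥0∞) ^ m)⁻¹.toReal *
        ∑ g ∈ G, ∑ s, (if v ≤ (correctGuesses g s : ℝ) then a g s else 0) := by
        rw [Finset.sum_comm]
    _ ≤ ((2 : ℝ≥0∞) ^ m)⁻¹.toReal * ∑ g ∈ G, T * ∑ s, a g s := by
        gcongr with g hg
        exact ha_le g hg
    _ = ((2 : ℝ≥0∞) ^ m)⁻¹.toReal * (T * ∑ s : Fin m → Bool, (1 : ℝ)) := by
        rw [← Finset.mul_sum, Finset.sum_comm]
        congr 2
        refine Finset.sum_congr rfl fun s _ => ?_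
        simpa using ha_sum s (fun _ => True) inferInstance
    _ = T := by
        simp
        field_simp
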